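/- Let ψ ∈ C²(ℝ) be uniformly strictly convex, ψ''(x) ≥ λ₀ > 0 for all x. Then there exists C > 0 depending only on ψ such that for every N ∈ ℕ, every m ∈ ℝ, every a ∈ ℝ^N, and every smooth f ≥ 0 on X_{N,m} with ∫ f dμ_{N,a,m} = 1, one has |cov_{μ_{N,a,m}}(f, (1/N)∑_{i=1}^N ψ'(x_i))|² ≤ C N ∫ |∇f|²/f dμ_{N,a,m}, where ∇f is the tangential gradient of f along X_{N,m}. -/

import Mathlib

open MeasureTheory ENNReal Real

noncomputable section

/-- The canonical ensemble `μ_{K,a,m}` on the hyperplane `X_{K,m}`, with density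
`Z⁻¹ exp(-∑ (ψ(xᵢ) + aᵢxᵢ))` with respect to `(K-1)`-dimensional Hausdorff measure. -/
def canonEns (ψ : ℝ → ℝ) (N : ℕ) (a : Fin N → ℝ) (m : ℝ) :
    Measure (EuclideanSpace ℝ (Fin N)) :=
  let ν : Measure (EuclideanSpace ℝ (Fin N)) :=
    ((μH[(N : ℝ) - 1]).restrict {x : EuclideanSpace ℝ (Fin N) | ∑ i, x i = (N : ℝ) * m}).withDensity
      fun x => ENNReal.ofReal (Real.exp (-(∑ i, (ψ (x i) + a i * x i))))
  (ν Set.univ)⁻¹ • ν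

/-- Covariance of two real functions with respect to a measure. -/
def covFn {X : Type*} [MeasurableSpace X] (μ : Measure X) (f g : X → ℝ) : ℝ :=
  (∫ x, f x * g x ∂μ) - (∫ x, f x ∂μ) * (∫ x, g x ∂μ)

/-- `|∇f|²/f` where `∇f` is the tangential gradient along `X_{N,m}`, i.e. the projection of
the Euclidean gradient onto `{v : ∑ vᵢ = 0}`; interpreted as `0` where `f = 0`. -/
def fisherX (N : ℕ) (f : EuclideanSpace ℝ (Fin N) → ℝ) (x : EuclideanSpace ℝ (Fin N)) : ℝ :=
  if f x = 0 then 0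
  else (∑ i, (gradient f x i - (∑ j, gradient f x j) / (N : ℝ)) ^ 2) / f x

open Filter Topology Set

section Convolution

variable {φ φ' χ : ℝ → ℝ} {C : ℝ}

theorem integrable_comp_sub_mul {ν : Measure ℝ} (hφ : Continuous φ) (hC : ∀ x, |φ x| ≤ C)
    (hχ : Integrable χ ν) (s : ℝ) : Integrable (fun v => φ (s - v) * χ v) ν :=
  hχ.bdd_mul (c := C) (by fun_prop) (ae_of_all _ fun v => by simpa using hC (s - v))

theorem continuous_integral_comp_sub_mul {ν : Measure ℝ} (hφ : Continuous φ)
    (hC : ∀ x, |φ x| ≤ C) (hχ : Integrable χ ν) :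
    Continuous fun s => ∫ v, φ (s - v) * χ v ∂ν := by
  refine continuous_of_dominated (bound := fun v => C * |χ v|)
    (fun s => (integrable_comp_sub_mul hφ hC hχ s).aestronglyMeasurable)
    (fun s => ae_of_all _ fun v => ?_) (hχ.abs.const_mul C) (ae_of_all _ fun v => by fun_prop)
  rw [norm_mul]
  exact mul_le_mul_of_nonneg_right (hC _) (abs_nonneg _)

theorem hasDerivAt_integral_comp_sub_mul {ν : Measure ℝ} (hφ : ∀ x, HasDerivAt φ (φ' x) x)
    (hφ' : Continuous φ') (hC : ∀ x, |φ x| ≤ C) {C' : ℝ} (hC' : ∀ x, |φ' x| ≤ C')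
    (hχ : Integrable χ ν) (s : ℝ) :
    HasDerivAt (fun s => ∫ v, φ (s - v) * χ v ∂ν) (∫ v, φ' (s - v) * χ v ∂ν) s := by
  have hcont : Continuous φ := continuous_iff_continuousAt.2 fun x => (hφ x).continuousAt
  refine (hasDerivAt_integral_of_dominated_loc_of_deriv_le (s := univ)
    (F := fun s v => φ (s - v) * χ v) (F' := fun s v => φ' (s - v) * χ v)
    (bound := fun v => C' * |χ v|) univ_mem
    (Eventually.of_forall fun s => (integrable_comp_sub_mul hcont hC hχ s).aestronglyMeasurable)
    (integrable_comp_sub_mul hcont hC hχ s)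
    (integrable_comp_sub_mul hφ' hC' hχ s).aestronglyMeasurable
    (ae_of_all _ fun v s _ => ?_) (hχ.abs.const_mul C') (ae_of_all _ fun v s _ => ?_)).2
  · rw [norm_mul]
    exact mul_le_mul_of_nonneg_right (hC' _) (abs_nonneg _)
  · have := ((hφ (s - v)).comp s ((hasDerivAt_id s).sub_const v)).mul_const (χ v)
    simpa using this

theorem integral_Ioi_eq_sub {F : ℝ → ℝ} (hF : Integrable F) (r : ℝ) :
    ∫ v in Ioi r, F v = (∫ v in Ioi 0, F v) - ∫ v in (0 : ℝ)..r, F v := by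
  have := intervalIntegral.integral_interval_add_Ioi (a := 0) (b := r) hF.integrableOn
    hF.integrableOn
  linarith

theorem contDiff_one_of_hasDerivAt_partial {g g₁ g₂ : ℝ → ℝ → ℝ}
    (h₁ : ∀ s r, HasDerivAt (fun s => g s r) (g₁ s r) s)
    (h₂ : ∀ s r, HasDerivAt (fun r => g s r) (g₂ s r) r)
    (c₁ : Continuous fun z : ℝ × ℝ => g₁ z.1 z.2)
    (c₂ : Continuous fun z : ℝ × ℝ => g₂ z.1 z.2) :
    ContDiff ℝ 1 (fun z : ℝ × ℝ => g z.1 z.2) := by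
  let f₁ : ℝ → ℝ → ℝ →L[ℝ] ℝ := fun s r => ContinuousLinearMap.toSpanSingleton ℝ (g₁ s r)
  let f₂ : ℝ → ℝ → ℝ →L[ℝ] ℝ := fun s r => ContinuousLinearMap.toSpanSingleton ℝ (g₂ s r)
  have k₁ : Continuous fun z : ℝ × ℝ => f₁ z.1 z.2 :=
    (ContinuousLinearMap.toSpanSingletonCLE (𝕜 := ℝ) (E := ℝ)).continuous.comp c₁
  have k₂ : Continuous fun z : ℝ × ℝ => f₂ z.1 z.2 :=
    (ContinuousLinearMap.toSpanSingletonCLE (𝕜 := ℝ) (E := ℝ)).continuous.comp c₂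
  rw [contDiff_one_iff_hasFDerivAt]
  refine ⟨fun z => (f₁ z.1 z.2).coprod (f₂ z.1 z.2), ?_, fun z => ?_⟩
  · have : (fun z : ℝ × ℝ => (f₁ z.1 z.2).coprod (f₂ z.1 z.2)) = fun z =>
        (f₁ z.1 z.2).comp (ContinuousLinearMap.fst ℝ ℝ ℝ)
          + (f₂ z.1 z.2).comp (ContinuousLinearMap.snd ℝ ℝ ℝ) := by
      ext z <;> simp
    rw [this]
    exact (k₁.clm_comp continuous_const).add (k₂.clm_comp continuous_const)
  · exact (hasStrictFDerivAt_uncurry_coprod (f := g) (f₁ := f₁) (f₂ := f₂)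
      (Eventually.of_forall fun v => (h₁ v.1 v.2).hasFDerivAt)
      (Eventually.of_forall fun v => (h₂ v.1 v.2).hasFDerivAt)
      k₁.continuousAt k₂.continuousAt).hasFDerivAt

theorem continuous_integral_Ioi_comp_sub_mul (hφ : Continuous φ) (hC : ∀ x, |φ x| ≤ C)
    (hχ : Integrable χ) (hχc : Continuous χ) :
    Continuous fun z : ℝ × ℝ => ∫ v in Ioi z.2, φ (z.1 - v) * χ v := by
  simp_rw [fun z : ℝ × ℝ => integral_Ioi_eq_sub (integrable_comp_sub_mul hφ hC hχ z.1) z.2]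
  refine ((continuous_integral_comp_sub_mul hφ hC hχ.integrableOn).comp continuous_fst).sub ?_
  exact intervalIntegral.continuous_parametric_intervalIntegral_of_continuous
    (f := fun (z : ℝ × ℝ) v => φ (z.1 - v) * χ v) (by fun_prop) continuous_snd

theorem hasDerivAt_integral_Ioi {F : ℝ → ℝ} (hF : Integrable F) (hFc : Continuous F) (r : ℝ) :
    HasDerivAt (fun r => ∫ v in Ioi r, F v) (-F r) r := by
  rw [funext (integral_Ioi_eq_sub hF)]
  simpa using (intervalIntegral.integral_hasDerivAt_right (hF.intervalIntegrable)
    (hFc.stronglyMeasurableAtFilter _ _) hFc.continuousAt).const_sub (∫ v in Ioi 0, F v)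

theorem contDiff_integral_Ioi_comp_sub_mul (hφ : ∀ x, HasDerivAt φ (φ' x) x)
    (hφ' : Continuous φ') (hC : ∀ x, |φ x| ≤ C) {C' : ℝ} (hC' : ∀ x, |φ' x| ≤ C')
    (hχ : Integrable χ) (hχc : Continuous χ) :
    ContDiff ℝ 1 fun z : ℝ × ℝ => ∫ v in Ioi z.2, φ (z.1 - v) * χ v := by
  have hcont : Continuous φ := continuous_iff_continuousAt.2 fun x => (hφ x).continuousAt
  exact contDiff_one_of_hasDerivAt_partial
    (g := fun s r => ∫ v in Ioi r, φ (s - v) * χ v)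
    (fun s r => hasDerivAt_integral_comp_sub_mul hφ hφ' hC hC' hχ.integrableOn s)
    (fun s r => hasDerivAt_integral_Ioi (integrable_comp_sub_mul hcont hC hχ s) (by fun_prop) r)
    (continuous_integral_Ioi_comp_sub_mul hφ' hC' hχ hχc) (by fun_prop)

end Convolution

theorem integral_Ioi_nonneg_of_monotone {g w : ℝ → ℝ} (hg : Monotone g) (hw : ∀ x, 0 ≤ w x)
    (hi : Integrable fun x => g x * w x) (h0 : 0 ≤ ∫ x, g x * w x) (r : ℝ) :
    0 ≤ ∫ x in Ioi r, g x * w x := by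
  rcases le_total 0 (g r) with h | h
  · exact setIntegral_nonneg measurableSet_Ioi fun x hx =>
      mul_nonneg (h.trans (hg (le_of_lt hx))) (hw x)
  · have h1 : ∫ x in Iic r, g x * w x ≤ 0 := setIntegral_nonpos measurableSet_Iic fun x hx =>
      mul_nonpos_of_nonpos_of_nonneg ((hg hx).trans h) (hw x)
    have h2 := integral_add_compl (measurableSet_Iic (a := r)) hi
    rw [compl_Iic] at h2
    linarith

theorem exists_eq_zero_of_integral_mul_eq_zero {f w : ℝ → ℝ} (hf : Continuous f)
    (hw : ∀ x, 0 < w x) (hi : Integrable fun x => f x * w x) (h0 : ∫ x, f x * w x = 0) :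
    ∃ x, f x = 0 := by
  have key : ∀ g : ℝ → ℝ, Integrable g → ∫ x, g x = 0 → ∃ x, g x ≤ 0 := by
    intro g hg hg0
    by_contra! hpos
    have : 0 < ∫ x, g x := by
      rw [integral_pos_iff_support_of_nonneg (fun x => (hpos x).le) hg,
        show Function.support g = univ from eq_univ_of_forall fun x => (hpos x).ne']
      simp
    exact this.ne' hg0
  obtain ⟨a, ha⟩ := key _ hi h0
  obtain ⟨b, hb⟩ := key _ hi.neg (by simp [integral_neg, h0])
  refine mem_range_of_exists_le_of_exists_ge hf ⟨a, ?_⟩ ⟨b, ?_⟩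
  · exact nonpos_of_mul_nonpos_left ha (hw a)
  · simp only [Pi.neg_apply, neg_nonpos] at hb
    exact nonneg_of_mul_nonneg_left hb (hw b)

/-- A positive, bounded, integrable density `ρ` on the line whose logarithmic derivative `θ` is
continuous, bounded and nonincreasing; in particular `ρ` is log-concave. -/
structure LogConcaveDensity (ρ θ : ℝ → ℝ) : Prop where
  pos : ∀ x, 0 < ρ x
  hasDerivAt : ∀ x, HasDerivAt ρ (θ x * ρ x) x
  continuous_score : Continuous θ
  antitone_score : Antitone θ
  bounded_score : ∃ C, ∀ x, |θ x| ≤ C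
  integrable : Integrable ρ
  bounded : ∃ C, ∀ x, |ρ x| ≤ C

namespace LogConcaveDensity

variable {ρ θ R η : ℝ → ℝ}

theorem continuous (h : LogConcaveDensity ρ θ) : Continuous ρ :=
  continuous_iff_continuousAt.2 fun x => (h.hasDerivAt x).continuousAt

theorem continuous_deriv (h : LogConcaveDensity ρ θ) : Continuous fun x => θ x * ρ x :=
  h.continuous_score.mul h.continuous

theorem contDiff (h : LogConcaveDensity ρ θ) : ContDiff ℝ 1 ρ := by
  rw [contDiff_one_iff_deriv]
  refine ⟨fun x => (h.hasDerivAt x).differentiableAt, ?_⟩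
  rw [funext fun x => (h.hasDerivAt x).deriv]
  exact h.continuous_deriv

theorem integrable_deriv (h : LogConcaveDensity ρ θ) : Integrable fun x => θ x * ρ x := by
  obtain ⟨C, hC⟩ := h.bounded_score
  exact h.integrable.bdd_mul (c := C) h.continuous_score.aestronglyMeasurable (ae_of_all _ hC)

theorem bounded_deriv (h : LogConcaveDensity ρ θ) : ∃ C, ∀ x, |θ x * ρ x| ≤ C := by
  obtain ⟨C, hC⟩ := h.bounded_score
  obtain ⟨B, hB⟩ := h.bounded
  exact ⟨C * B, fun x => by
    rw [abs_mul]
    exact mul_le_mul (hC x) (hB x) (abs_nonneg _) ((abs_nonneg _).trans (hC x))⟩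

/-- The convolution of two densities. -/
def conv (ρ R : ℝ → ℝ) (s : ℝ) : ℝ := ∫ v, ρ (s - v) * R v

/-- The logarithmic derivative of the convolution of two densities. -/
def convScore (ρ θ R : ℝ → ℝ) (s : ℝ) : ℝ := conv (fun x => θ x * ρ x) R s / conv ρ R s

theorem conv_comm (ρ R : ℝ → ℝ) : conv ρ R = conv R ρ := by
  ext s
  unfold conv
  rw [← integral_sub_left_eq_self _ volume s]
  refine integral_congr_ae (ae_of_all _ fun v => ?_)
  simp [mul_comm]

theorem integrable_conv_integrand (h : LogConcaveDensity ρ θ) (k : LogConcaveDensity R η) (s : ℝ) :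
    Integrable fun v => ρ (s - v) * R v := by
  obtain ⟨B, hB⟩ := h.bounded
  exact integrable_comp_sub_mul h.continuous hB k.integrable s

theorem conv_pos (h : LogConcaveDensity ρ θ) (k : LogConcaveDensity R η) (s : ℝ) :
    0 < conv ρ R s := by
  have hp : ∀ v, 0 < ρ (s - v) * R v := fun v => mul_pos (h.pos _) (k.pos _)
  unfold conv
  rw [integral_pos_iff_support_of_nonneg (fun v => (hp v).le) (integrable_conv_integrand h k s)]
  have : Function.support (fun v => ρ (s - v) * R v) = univ := by
    ext v; simpa using (hp v).ne'
  simp [this]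

theorem hasDerivAt_conv (h : LogConcaveDensity ρ θ) {χ : ℝ → ℝ} (hχ : Integrable χ) (s : ℝ) :
    HasDerivAt (conv ρ χ) (conv (fun x => θ x * ρ x) χ s) s := by
  obtain ⟨B, hB⟩ := h.bounded
  obtain ⟨B', hB'⟩ := h.bounded_deriv
  exact hasDerivAt_integral_comp_sub_mul h.hasDerivAt h.continuous_deriv hB hB' hχ s

theorem conv_deriv_comm (h : LogConcaveDensity ρ θ) (k : LogConcaveDensity R η) :
    conv (fun x => θ x * ρ x) R = conv ρ (fun x => η x * R x) := by
  ext s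
  have h1 := hasDerivAt_conv h k.integrable s
  have h2 := hasDerivAt_conv k h.integrable s
  rw [conv_comm R ρ, conv_comm _ ρ] at h2
  exact h1.unique h2

theorem convScore_mul (h : LogConcaveDensity ρ θ) (k : LogConcaveDensity R η) (s : ℝ) :
    convScore ρ θ R s * conv ρ R s = conv (fun x => θ x * ρ x) R s :=
  div_mul_cancel₀ _ (conv_pos h k s).ne'

theorem hasDerivAt_conv_deriv (h : LogConcaveDensity ρ θ) (k : LogConcaveDensity R η) (s : ℝ) :
    HasDerivAt (conv (fun x => θ x * ρ x) R)
      (conv (fun x => θ x * ρ x) (fun x => η x * R x) s) s := by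
  rw [conv_deriv_comm h k]
  exact hasDerivAt_conv h k.integrable_deriv s

theorem hasDerivAt_convScore (h : LogConcaveDensity ρ θ) (k : LogConcaveDensity R η) (s : ℝ) :
    HasDerivAt (convScore ρ θ R)
      ((conv (fun x => θ x * ρ x) (fun x => η x * R x) s * conv ρ R s
        - conv (fun x => θ x * ρ x) R s * conv (fun x => θ x * ρ x) R s) / conv ρ R s ^ 2) s :=
  (hasDerivAt_conv_deriv h k s).div (hasDerivAt_conv h k.integrable s) (conv_pos h k s).ne'

theorem continuous_conv (h : LogConcaveDensity ρ θ) {χ : ℝ → ℝ} (hχ : Integrable χ) :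
    Continuous (conv ρ χ) := by
  obtain ⟨B, hB⟩ := h.bounded
  exact continuous_integral_comp_sub_mul h.continuous hB hχ

theorem continuous_conv_deriv (h : LogConcaveDensity ρ θ) {χ : ℝ → ℝ} (hχ : Integrable χ) :
    Continuous (conv (fun x => θ x * ρ x) χ) := by
  obtain ⟨B, hB⟩ := h.bounded_deriv
  exact continuous_integral_comp_sub_mul h.continuous_deriv hB hχ

theorem contDiff_convScore (h : LogConcaveDensity ρ θ) (k : LogConcaveDensity R η) :
    ContDiff ℝ 1 (convScore ρ θ R) := by
  rw [contDiff_one_iff_deriv]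
  refine ⟨fun s => (hasDerivAt_convScore h k s).differentiableAt, ?_⟩
  rw [funext fun s => (hasDerivAt_convScore h k s).deriv]
  have c1 := continuous_conv h k.integrable
  have c2 := continuous_conv_deriv h k.integrable
  have c3 := continuous_conv_deriv h k.integrable_deriv
  exact ((c3.mul c1).sub (c2.mul c2)).div (c1.pow 2) fun s => (pow_pos (conv_pos h k s) 2).ne'

theorem integrable_conv_deriv_left (h : LogConcaveDensity ρ θ) (k : LogConcaveDensity R η) (s : ℝ) :
    Integrable fun v => (θ (s - v) * ρ (s - v)) * R v := by
  obtain ⟨B, hB⟩ := h.bounded_deriv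
  exact integrable_comp_sub_mul h.continuous_deriv hB k.integrable s

theorem integrable_conv_deriv_right (h : LogConcaveDensity ρ θ) (k : LogConcaveDensity R η)
    (s : ℝ) : Integrable fun v => ρ (s - v) * (η v * R v) := by
  obtain ⟨B, hB⟩ := h.bounded
  exact integrable_comp_sub_mul h.continuous hB k.integrable_deriv s

theorem integrable_conv_deriv_both (h : LogConcaveDensity ρ θ) (k : LogConcaveDensity R η)
    (s : ℝ) : Integrable fun v => (θ (s - v) * ρ (s - v)) * (η v * R v) := by
  obtain ⟨B, hB⟩ := h.bounded_deriv
  exact integrable_comp_sub_mul h.continuous_deriv hB k.integrable_deriv s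

/-- Under the conditional law of the two summands given their sum, the two scores are negatively
correlated. -/
theorem conv_deriv_mul_le (h : LogConcaveDensity ρ θ) (k : LogConcaveDensity R η) (s : ℝ) :
    conv (fun x => θ x * ρ x) (fun x => η x * R x) s * conv ρ R s
      ≤ conv (fun x => θ x * ρ x) R s * conv (fun x => θ x * ρ x) R s := by
  set c := convScore ρ θ R s with hc
  have hZ := conv_pos h k s
  have hcZ : c * conv ρ R s = conv (fun x => θ x * ρ x) R s := convScore_mul h k s
  have hcZ' : c * conv ρ R s = conv ρ (fun x => η x * R x) s := by rw [hcZ, conv_deriv_comm h k]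
  have i0 := integrable_conv_integrand h k s
  have i1 := integrable_conv_deriv_left h k s
  have i2 := integrable_conv_deriv_right h k s
  have i3 := integrable_conv_deriv_both h k s
  obtain ⟨v₀, hv₀⟩ : ∃ v₀, η v₀ = c := by
    have hint : ∫ v, (η v - c) * (ρ (s - v) * R v) = 0 := by
      have : ∀ v, (η v - c) * (ρ (s - v) * R v)
          = ρ (s - v) * (η v * R v) - c * (ρ (s - v) * R v) := fun v => by ring
      simp_rw [this]
      rw [integral_sub i2 (i0.const_mul c), integral_const_mul]
      exact sub_eq_zero.2 hcZ'.symm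
    have hi : Integrable fun v => (η v - c) * (ρ (s - v) * R v) := by
      have := i2.sub (i0.const_mul c)
      refine this.congr (ae_of_all _ fun v => ?_)
      simp only [Pi.sub_apply]; ring
    obtain ⟨v, hv⟩ := exists_eq_zero_of_integral_mul_eq_zero
      (k.continuous_score.sub continuous_const) (fun v => mul_pos (h.pos _) (k.pos _)) hi hint
    exact ⟨v, sub_eq_zero.1 hv⟩
  have hneg : ∫ v, (θ (s - v) - θ (s - v₀)) * (η v - c) * (ρ (s - v) * R v) ≤ 0 := by
    refine integral_nonpos fun v => ?_
    refine mul_nonpos_of_nonpos_of_nonneg ?_ (mul_pos (h.pos _) (k.pos _)).le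
    rw [← hv₀]
    rcases le_total v v₀ with hv | hv
    · exact mul_nonpos_of_nonpos_of_nonneg
        (sub_nonpos.2 (h.antitone_score (by linarith))) (sub_nonneg.2 (k.antitone_score hv))
    · exact mul_nonpos_of_nonneg_of_nonpos
        (sub_nonneg.2 (h.antitone_score (by linarith))) (sub_nonpos.2 (k.antitone_score hv))
  have hexp : ∫ v, (θ (s - v) - θ (s - v₀)) * (η v - c) * (ρ (s - v) * R v)
      = (conv (fun x => θ x * ρ x) (fun x => η x * R x) s - c * conv (fun x => θ x * ρ x) R s)
        - θ (s - v₀) * (conv ρ (fun x => η x * R x) s - c * conv ρ R s) := by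
    have : ∀ v, (θ (s - v) - θ (s - v₀)) * (η v - c) * (ρ (s - v) * R v)
        = ((θ (s - v) * ρ (s - v)) * (η v * R v) - c * ((θ (s - v) * ρ (s - v)) * R v))
          - θ (s - v₀) * (ρ (s - v) * (η v * R v) - c * (ρ (s - v) * R v)) := fun v => by ring
    have j1 : Integrable fun v =>
        (θ (s - v) * ρ (s - v)) * (η v * R v) - c * ((θ (s - v) * ρ (s - v)) * R v) :=
      i3.sub (i1.const_mul c)
    have j2 : Integrable fun v =>
        θ (s - v₀) * (ρ (s - v) * (η v * R v) - c * (ρ (s - v) * R v)) :=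
      (i2.sub (i0.const_mul c)).const_mul _
    simp_rw [this]
    rw [integral_sub j1 j2,
      integral_sub i3 (i1.const_mul c), integral_const_mul, integral_const_mul,
      integral_sub i2 (i0.const_mul c), integral_const_mul]
    rfl
  rw [hexp, ← hcZ', sub_self, mul_zero, sub_zero] at hneg
  have h1 := mul_le_mul_of_nonneg_right hneg hZ.le
  have h2 : conv (fun x => θ x * ρ x) R s * conv (fun x => θ x * ρ x) R s
      = c * conv ρ R s * conv (fun x => θ x * ρ x) R s := by rw [hcZ]
  linarith

theorem conv_logConcaveDensity (h : LogConcaveDensity ρ θ) (k : LogConcaveDensity R η) :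
    LogConcaveDensity (conv ρ R) (convScore ρ θ R) where
  pos := conv_pos h k
  hasDerivAt s := by
    rw [convScore_mul h k]
    exact hasDerivAt_conv h k.integrable s
  continuous_score := (contDiff_convScore h k).continuous
  antitone_score := by
    refine antitone_of_hasDerivAt_nonpos (hasDerivAt_convScore h k) fun s => ?_
    exact div_nonpos_of_nonpos_of_nonneg (sub_nonpos.2 (conv_deriv_mul_le h k s)) (sq_nonneg _)
  bounded_score := by
    obtain ⟨C, hC⟩ := h.bounded_score
    refine ⟨C, fun s => ?_⟩
    have hZ := conv_pos h k s
    rw [convScore, abs_div, abs_of_pos hZ, div_le_iff₀ hZ]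
    unfold conv
    rw [← integral_const_mul]
    refine (abs_integral_le_integral_abs).trans (integral_mono
      (integrable_conv_deriv_left h k s).abs ((integrable_conv_integrand h k s).const_mul C) ?_)
    intro v
    have : 0 < ρ (s - v) * R v := mul_pos (h.pos _) (k.pos _)
    simp only [mul_assoc]
    rw [abs_mul, abs_of_pos this]
    exact mul_le_mul_of_nonneg_right (hC _) this.le
  integrable := by
    have := k.integrable.integrable_convolution (ContinuousLinearMap.mul ℝ ℝ) h.integrable
    refine this.congr (ae_of_all _ fun s => ?_)
    simp only [convolution_def, conv, ContinuousLinearMap.mul_apply']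
    exact integral_congr_ae (ae_of_all _ fun v => mul_comm _ _)
  bounded := by
    obtain ⟨B, hB⟩ := h.bounded
    refine ⟨∫ v, B * R v, fun s => ?_⟩
    unfold conv
    refine (abs_integral_le_integral_abs).trans (integral_mono
      (integrable_conv_integrand h k s).abs (k.integrable.const_mul B) fun v => ?_)
    simp only
    rw [abs_mul, abs_of_pos (k.pos v)]
    exact mul_le_mul_of_nonneg_right (hB _) (k.pos v).le

/-- The flux through the point `r` for the second summand when the sum moves away from `s`,
relative to the conditional density. -/
def splitFlux (ρ θ R η : ℝ → ℝ) (s r : ℝ) : ℝ :=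
  (convScore ρ θ R s * (∫ v in Ioi r, ρ (s - v) * R v)
    - ∫ v in Ioi r, ρ (s - v) * (η v * R v)) / (ρ (s - r) * R r)

theorem contDiff_splitFlux (h : LogConcaveDensity ρ θ) (k : LogConcaveDensity R η) :
    ContDiff ℝ 1 fun z : ℝ × ℝ => splitFlux ρ θ R η z.1 z.2 := by
  obtain ⟨B, hB⟩ := h.bounded
  obtain ⟨B', hB'⟩ := h.bounded_deriv
  have c1 := contDiff_integral_Ioi_comp_sub_mul h.hasDerivAt h.continuous_deriv hB hB'
    k.integrable k.continuous
  have c2 := contDiff_integral_Ioi_comp_sub_mul h.hasDerivAt h.continuous_deriv hB hB'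
    k.integrable_deriv k.continuous_deriv
  have c3 := contDiff_convScore h k
  have c4 := h.contDiff
  have c5 := k.contDiff
  exact (((c3.comp contDiff_fst).mul c1).sub c2).div
    ((c4.comp (contDiff_fst.sub contDiff_snd)).mul (c5.comp contDiff_snd))
    fun z => (mul_pos (h.pos _) (k.pos _)).ne'

theorem integral_Ioi_deriv_sub (h : LogConcaveDensity ρ θ) (k : LogConcaveDensity R η) (s r : ℝ) :
    (∫ v in Ioi r, (θ (s - v) * ρ (s - v)) * R v) - (∫ v in Ioi r, ρ (s - v) * (η v * R v))
      = ρ (s - r) * R r := by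
  have i0 := integrable_conv_integrand h k s
  have i1 := integrable_conv_deriv_left h k s
  have i2 := integrable_conv_deriv_right h k s
  have hd : ∀ v, HasDerivAt (fun v => ρ (s - v) * R v)
      (ρ (s - v) * (η v * R v) - (θ (s - v) * ρ (s - v)) * R v) v := fun v => by
    have := ((h.hasDerivAt (s - v)).comp v ((hasDerivAt_id v).const_sub s)).mul (k.hasDerivAt v)
    refine this.congr_deriv ?_
    simp only [Function.comp]
    ring
  have hlim := tendsto_zero_of_hasDerivAt_of_integrableOn_Ioi (a := r) (fun v _ => hd v)
    (i2.sub i1).integrableOn i0.integrableOn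
  have := integral_Ioi_of_hasDerivAt_of_tendsto (hd r).continuousAt.continuousWithinAt
    (fun v _ => hd v) (i2.sub i1).integrableOn hlim
  rw [integral_sub i2.integrableOn i1.integrableOn] at this
  linarith

theorem splitFlux_nonneg (h : LogConcaveDensity ρ θ) (k : LogConcaveDensity R η) (s r : ℝ) :
    0 ≤ splitFlux ρ θ R η s r := by
  have i0 := integrable_conv_integrand h k s
  have i2 := integrable_conv_deriv_right h k s
  have e : ∀ v, (convScore ρ θ R s - η v) * (ρ (s - v) * R v)
      = convScore ρ θ R s * (ρ (s - v) * R v) - ρ (s - v) * (η v * R v) := fun v => by ring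
  have hpos := integral_Ioi_nonneg_of_monotone (g := fun v => convScore ρ θ R s - η v)
    (w := fun v => ρ (s - v) * R v) (fun a b hab => sub_le_sub_left (k.antitone_score hab) _)
    (fun v => (mul_pos (h.pos _) (k.pos _)).le)
    (by simp_rw [e]; exact (i0.const_mul _).sub i2)
    (by
      simp_rw [e]
      rw [integral_sub (i0.const_mul _) i2, integral_const_mul]
      have := convScore_mul h k s
      rw [conv_deriv_comm h k] at this
      exact (sub_eq_zero.2 this).ge) r
  simp_rw [e] at hpos
  rw [integral_sub (i0.const_mul _).integrableOn i2.integrableOn, integral_const_mul] at hpos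
  exact div_nonneg hpos (mul_pos (h.pos _) (k.pos _)).le

theorem splitFlux_le_one (h : LogConcaveDensity ρ θ) (k : LogConcaveDensity R η) (s r : ℝ) :
    splitFlux ρ θ R η s r ≤ 1 := by
  have i0 := integrable_conv_integrand h k s
  have i1 := integrable_conv_deriv_left h k s
  have e : ∀ v, (θ (s - v) - convScore ρ θ R s) * (ρ (s - v) * R v)
      = (θ (s - v) * ρ (s - v)) * R v - convScore ρ θ R s * (ρ (s - v) * R v) :=
    fun v => by ring
  have hpos := integral_Ioi_nonneg_of_monotone (g := fun v => θ (s - v) - convScore ρ θ R s)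
    (w := fun v => ρ (s - v) * R v)
    (fun a b hab => sub_le_sub_right (h.antitone_score (by linarith)) _)
    (fun v => (mul_pos (h.pos _) (k.pos _)).le)
    (by simp_rw [e]; exact i1.sub (i0.const_mul _))
    (by
      simp_rw [e]
      rw [integral_sub i1 (i0.const_mul _), integral_const_mul]
      exact (sub_eq_zero.2 (convScore_mul h k s).symm).ge) r
  simp_rw [e] at hpos
  rw [integral_sub i1.integrableOn (i0.const_mul _).integrableOn, integral_const_mul] at hpos
  rw [splitFlux, div_le_one (mul_pos (h.pos _) (k.pos _)), ← integral_Ioi_deriv_sub h k s r]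
  linarith

theorem hasDerivAt_splitFlux (h : LogConcaveDensity ρ θ) (k : LogConcaveDensity R η) (s r : ℝ) :
    HasDerivAt (fun r => splitFlux ρ θ R η s r)
      (η r - convScore ρ θ R s + splitFlux ρ θ R η s r * (θ (s - r) - η r)) r := by
  have hw : HasDerivAt (fun r => ρ (s - r) * R r)
      (ρ (s - r) * R r * (η r - θ (s - r))) r := by
    have := ((h.hasDerivAt (s - r)).comp r ((hasDerivAt_id r).const_sub s)).mul (k.hasDerivAt r)
    refine this.congr_deriv ?_
    simp only [Function.comp]
    ring
  have d1 := hasDerivAt_integral_Ioi (integrable_conv_integrand h k s)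
    ((h.continuous.comp (continuous_const.sub continuous_id)).mul k.continuous) r
  have d2 := hasDerivAt_integral_Ioi (integrable_conv_deriv_right h k s)
    ((h.continuous.comp (continuous_const.sub continuous_id)).mul k.continuous_deriv) r
  have hne : ρ (s - r) * R r ≠ 0 := (mul_pos (h.pos _) (k.pos _)).ne'
  have h1 := (h.pos (s - r)).ne'
  have h2 := (k.pos r).ne'
  refine (((d1.const_mul (convScore ρ θ R s)).sub d2).div hw hne).congr_deriv ?_
  simp only [splitFlux, Pi.sub_apply]
  field_simp
  ring

/-- When the sum of two independent log-concave variables is moved, the displacement can be split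
between the summands by nonnegative continuously differentiable proportions `q` and `1 - q`. -/
theorem exists_split (h : LogConcaveDensity ρ θ) (k : LogConcaveDensity R η) :
    ∃ (Z ζ : ℝ → ℝ) (q : ℝ × ℝ → ℝ), LogConcaveDensity Z ζ ∧ ContDiff ℝ 1 q ∧
      (∀ z, 0 ≤ q z) ∧ (∀ z, q z ≤ 1) ∧
      ∀ t r, fderiv ℝ q (t, r) (1, -1) + q (t, r) * θ t + (1 - q (t, r)) * η r = ζ (t + r) := by
  have hq : ContDiff ℝ 1 fun z : ℝ × ℝ => splitFlux ρ θ R η (z.1 + z.2) z.2 :=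
    (contDiff_splitFlux h k).comp ((contDiff_fst.add contDiff_snd).prodMk contDiff_snd)
  refine ⟨conv ρ R, convScore ρ θ R, fun z => splitFlux ρ θ R η (z.1 + z.2) z.2,
    conv_logConcaveDensity h k, hq, fun z => splitFlux_nonneg h k _ _,
    fun z => splitFlux_le_one h k _ _, fun t r => ?_⟩
  have hline : HasDerivAt (fun x : ℝ => (t + r - x, x)) ((-1 : ℝ), (1 : ℝ)) r :=
    ((hasDerivAt_id r).const_sub (t + r)).prodMk (hasDerivAt_id r)
  have hfd := ((hq.differentiable one_ne_zero) (t + r - r, r)).hasFDerivAt.comp_hasDerivAt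
    (f := fun x : ℝ => (t + r - x, x)) r hline
  have hq' := hasDerivAt_splitFlux h k (t + r) r
  have heq : (fun z : ℝ × ℝ => splitFlux ρ θ R η (z.1 + z.2) z.2) ∘ (fun x : ℝ => (t + r - x, x))
      = fun x => splitFlux ρ θ R η (t + r) x := by
    ext x; simp
  rw [heq] at hfd
  have hu := hfd.unique hq'
  simp only [add_sub_cancel_right] at hu
  have hneg : ((1 : ℝ), (-1 : ℝ)) = -((-1 : ℝ), (1 : ℝ)) := by simp
  rw [hneg, map_neg, hu]
  ring

end LogConcaveDensity

/-- For independent log-concave coordinates there is a continuously differentiable vector field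
with values in the simplex whose divergence against the product density is a function of the
sum of the coordinates only. -/
theorem exists_simplex_field (n : ℕ) (ρ θ : Fin (n + 1) → ℝ → ℝ)
    (h : ∀ i, LogConcaveDensity (ρ i) (θ i)) :
    ∃ (Z ζ : ℝ → ℝ) (p : Fin (n + 1) → (Fin (n + 1) → ℝ) → ℝ), LogConcaveDensity Z ζ ∧
      (∀ i, ContDiff ℝ 1 (p i)) ∧ (∀ i x, 0 ≤ p i x) ∧ (∀ x, ∑ i, p i x = 1) ∧
      ∀ x, ∑ i, (fderiv ℝ (p i) x (Pi.single i 1) + p i x * θ i (x i)) = ζ (∑ i, x i) := by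
  induction n with
  | zero =>
    exact ⟨ρ 0, θ 0, fun _ _ => 1, h 0, fun _ => contDiff_const, fun _ _ => zero_le_one,
      fun _ => by simp, fun x => by simp⟩
  | succ n ih =>
    obtain ⟨R, η, p, hR, hp, hp0, hp1, hdiv⟩ :=
      ih (fun i => ρ i.succ) (fun i => θ i.succ) fun i => h i.succ
    obtain ⟨Z, ζ, q, hZ, hq, hq0, hq1, hqdiv⟩ := (h 0).exists_split hR
    let T : (Fin (n + 2) → ℝ) →L[ℝ] (Fin (n + 1) → ℝ) :=
      ContinuousLinearMap.pi fun i => ContinuousLinearMap.proj i.succ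
    let σ : (Fin (n + 2) → ℝ) →L[ℝ] ℝ × ℝ :=
      (ContinuousLinearMap.proj 0).prod (∑ i : Fin (n + 1), ContinuousLinearMap.proj i.succ)
    have hσ : ∀ x, σ x = (x 0, ∑ i : Fin (n + 1), x i.succ) := fun x => by
      simp [σ]
    have hT : ∀ x i, T x i = x i.succ := fun x i => rfl
    have hσ0 : σ (Pi.single 0 1) = (1, 0) := by simp [hσ]
    have hσs : ∀ i : Fin (n + 1), σ (Pi.single i.succ 1) = (0, 1) := fun i => by
      rw [hσ]
      simp [Pi.single_apply, Fin.succ_ne_zero i |>.symm]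
    have hTs : ∀ i : Fin (n + 1), T (Pi.single i.succ 1) = Pi.single i 1 := fun i => by
      ext j
      simp [hT, Pi.single_apply]
    have hqd : Differentiable ℝ q := hq.differentiable one_ne_zero
    refine ⟨Z, ζ, Fin.cons (fun x => q (σ x)) fun i x => (1 - q (σ x)) * p i (T x), hZ,
      ?_, ?_, ?_, ?_⟩
    · intro i
      refine Fin.cases ?_ (fun i => ?_) i
      · exact hq.comp σ.contDiff
      · exact (contDiff_const.sub (hq.comp σ.contDiff)).mul ((hp i).comp T.contDiff)
    · intro i x
      refine Fin.cases ?_ (fun i => ?_) i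
      · exact hq0 _
      · exact mul_nonneg (sub_nonneg.2 (hq1 _)) (hp0 i _)
    · intro x
      rw [Fin.sum_univ_succ]
      simp only [Fin.cons_zero, Fin.cons_succ, ← Finset.mul_sum, hp1]
      ring
    · intro x
      have hqσ : HasFDerivAt (fun x => q (σ x)) ((fderiv ℝ q (σ x)).comp σ) x :=
        (hqd (σ x)).hasFDerivAt.comp x σ.hasFDerivAt
      have hpT : ∀ i, HasFDerivAt (fun x => p i (T x)) ((fderiv ℝ (p i) (T x)).comp T) x :=
        fun i => ((hp i).differentiable one_ne_zero (T x)).hasFDerivAt.comp x T.hasFDerivAt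
      have hd : ∀ i, fderiv ℝ (fun x => (1 - q (σ x)) * p i (T x)) x (Pi.single i.succ 1)
          = (1 - q (σ x)) * fderiv ℝ (p i) (T x) (Pi.single i 1)
            - p i (T x) * fderiv ℝ q (σ x) (0, 1) := fun i => by
        have hm : HasFDerivAt (fun x => (1 - q (σ x)) * p i (T x)) _ x :=
          (hqσ.const_sub 1).mul (hpT i)
        rw [hm.fderiv]
        simp [hTs, hσs]
        ring
      have h01 : fderiv ℝ q (σ x) (1, 0) - fderiv ℝ q (σ x) (0, 1)
          = fderiv ℝ q (σ x) (1, -1) := by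
        rw [← map_sub]; simp
      rw [Fin.sum_univ_succ]
      simp only [Fin.cons_zero, Fin.cons_succ]
      rw [hqσ.fderiv]
      simp only [hd, ContinuousLinearMap.comp_apply, hσ0]
      have hsum : ∑ i : Fin (n + 1), ((1 - q (σ x)) * fderiv ℝ (p i) (T x) (Pi.single i 1)
            - p i (T x) * fderiv ℝ q (σ x) (0, 1)
            + (1 - q (σ x)) * p i (T x) * θ i.succ (x i.succ))
          = (1 - q (σ x)) * η (∑ i, T x i) - fderiv ℝ q (σ x) (0, 1) := by
        rw [← hdiv (T x), Finset.mul_sum]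
        have e : fderiv ℝ q (σ x) (0, 1) = ∑ i, p i (T x) * fderiv ℝ q (σ x) (0, 1) := by
          rw [← Finset.sum_mul, hp1, one_mul]
        conv_rhs => rw [e]
        rw [← Finset.sum_sub_distrib]
        refine Finset.sum_congr rfl fun i _ => ?_
        simp only [hT]
        ring
      rw [hsum]
      have := hqdiv (x 0) (∑ i : Fin (n + 1), x i.succ)
      rw [← hσ, ← h01] at this
      have hs : ∑ i, x i = x 0 + ∑ i : Fin (n + 1), x i.succ := Fin.sum_univ_succ _
      rw [hs, ← this]
      simp only [hT]
      ring

theorem integrableOn_Ioi_of_hasDerivAt_score {ρ θ : ℝ → ℝ} (hpos : ∀ x, 0 < ρ x)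
    (hderiv : ∀ x, HasDerivAt ρ (θ x * ρ x) x) {k : ℝ} {δ : ℝ} (hδ : 0 < δ)
    (hθ : ∀ x, k ≤ x → θ x ≤ -δ) :
    IntegrableOn ρ (Ioi k) ∧ ∀ x, k ≤ x → ρ x ≤ ρ k := by
  have hcont : Continuous ρ := continuous_iff_continuousAt.2 fun x => (hderiv x).continuousAt
  let G : ℝ → ℝ := fun x => ρ x * Real.exp (δ * x)
  have hG : ∀ x, HasDerivAt G ((θ x + δ) * (ρ x * Real.exp (δ * x))) x := fun x => by
    have := (hderiv x).mul (((hasDerivAt_id x).const_mul δ).exp)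
    refine this.congr_deriv ?_
    simp only [id]
    ring
  have hanti : AntitoneOn G (Ici k) := by
    refine antitoneOn_of_hasDerivWithinAt_nonpos (convex_Ici k)
      (fun x _ => (hG x).continuousAt.continuousWithinAt) (fun x _ => (hG x).hasDerivWithinAt) ?_
    intro x hx
    rw [interior_Ici] at hx
    have := hθ x (le_of_lt hx)
    exact mul_nonpos_of_nonpos_of_nonneg (by linarith)
      (mul_pos (hpos x) (Real.exp_pos _)).le
  have hle : ∀ x, k ≤ x → ρ x ≤ G k * Real.exp (-δ * x) := fun x hx => by
    have h1 : ρ x * Real.exp (δ * x) ≤ G k := hanti self_mem_Ici hx hx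
    calc ρ x = ρ x * Real.exp (δ * x) * Real.exp (-δ * x) := by
          rw [mul_assoc, ← Real.exp_add]; simp
      _ ≤ _ := mul_le_mul_of_nonneg_right h1 (Real.exp_pos _).le
  refine ⟨integrable_of_isBigO_exp_neg hδ hcont.continuousOn ?_, fun x hx => ?_⟩
  · refine Asymptotics.IsBigO.of_bound (G k) ?_
    filter_upwards [eventually_ge_atTop k] with x hx
    rw [Real.norm_of_nonneg (hpos x).le, Real.norm_of_nonneg (Real.exp_pos _).le]
    exact hle x hx
  · refine (hle x hx).trans ?_
    have : G k * Real.exp (-δ * x) = ρ k * Real.exp (δ * k + -δ * x) := by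
      rw [Real.exp_add, ← mul_assoc]
    rw [this]
    refine mul_le_of_le_one_right (hpos k).le (Real.exp_le_one_iff.2 ?_)
    nlinarith

/-- A continuous bounded nonincreasing function which changes sign is the score of a density. -/
theorem exists_logConcaveDensity {θ : ℝ → ℝ} (hc : Continuous θ) (ha : Antitone θ)
    (hb : ∃ C, ∀ x, |θ x| ≤ C) {k : ℝ} (h1 : θ k < 0) (h2 : 0 < θ (-k)) :
    ∃ ρ, LogConcaveDensity ρ θ := by
  have hk : -k ≤ k := by
    by_contra! hlt
    linarith [ha hlt.le]
  let ρ : ℝ → ℝ := fun x => Real.exp (∫ y in (0 : ℝ)..x, θ y)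
  have hpos : ∀ x, 0 < ρ x := fun x => Real.exp_pos _
  have hd : ∀ x, HasDerivAt ρ (θ x * ρ x) x := fun x => by
    have := (intervalIntegral.integral_hasDerivAt_right (hc.intervalIntegrable 0 x)
      (hc.stronglyMeasurableAtFilter _ _) hc.continuousAt).exp
    rwa [mul_comm] at this
  have hcont : Continuous ρ := continuous_iff_continuousAt.2 fun x => (hd x).continuousAt
  obtain ⟨i1, b1⟩ := integrableOn_Ioi_of_hasDerivAt_score hpos hd (neg_pos.2 h1)
    (fun x hx => by simpa using ha hx)
  have hd' : ∀ x, HasDerivAt (fun x => ρ (-x)) (-θ (-x) * ρ (-x)) x := fun x => by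
    have := (hd (-x)).comp x (hasDerivAt_neg x)
    refine this.congr_deriv ?_
    ring
  obtain ⟨i2, b2⟩ := integrableOn_Ioi_of_hasDerivAt_score (ρ := fun x => ρ (-x))
    (θ := fun x => -θ (-x)) (k := k) (fun x => hpos _) hd' h2
    (fun x hx => neg_le_neg (ha (neg_le_neg hx)))
  refine ⟨ρ, ⟨hpos, hd, hc, ha, hb, ?_, ?_⟩⟩
  · have i2' : IntegrableOn ρ (Iic (-k)) := by
      rw [integrableOn_Iic_iff_integrableOn_Iio]
      have := i2.comp_neg
      simpa using this
    have i3 : IntegrableOn ρ (Icc (-k) k) := hcont.integrableOn_Icc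
    have := (i2'.union i3).union i1
    rwa [Iic_union_Icc_eq_Iic hk, Iic_union_Ioi, integrableOn_univ] at this
  · obtain ⟨B, hB⟩ := (isCompact_Icc (a := -k) (b := k)).bddAbove_image hcont.continuousOn
    have hB' : ∀ x ∈ Icc (-k) k, ρ x ≤ B := fun x hx => hB (mem_image_of_mem _ hx)
    refine ⟨B, fun x => ?_⟩
    rw [abs_of_pos (hpos x)]
    rcases le_total x k with hx | hx
    · rcases le_total (-k) x with hx' | hx'
      · exact hB' x ⟨hx', hx⟩
      · have := b2 (-x) (by linarith)
        rw [neg_neg] at this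
        exact this.trans (hB' (-k) ⟨le_rfl, hk⟩)
    · exact (b1 x hx).trans (hB' k ⟨hk, le_rfl⟩)

section Hyperplane

variable {n : ℕ}

/-- The sum of the coordinates as a continuous linear functional. -/
def coordSum (n : ℕ) : EuclideanSpace ℝ (Fin n) →L[ℝ] ℝ := ∑ i, EuclideanSpace.proj i

theorem coordSum_apply (x : EuclideanSpace ℝ (Fin n)) : coordSum n x = ∑ i, x i := by
  simp [coordSum]

theorem finrank_ker_coordSum (n : ℕ) :
    Module.finrank ℝ (LinearMap.ker (coordSum (n + 1)).toLinearMap) = n := by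
  have hs : LinearMap.range (coordSum (n + 1)).toLinearMap = ⊤ := by
    rw [LinearMap.range_eq_top]
    intro c
    refine ⟨EuclideanSpace.single 0 c, ?_⟩
    change coordSum (n + 1) _ = c
    rw [coordSum_apply]
    simp
  have := LinearMap.finrank_range_add_finrank_ker (coordSum (n + 1)).toLinearMap
  rw [hs] at this
  simp at this
  omega

/-- The parametrization of the hyperplane of mean `m` by vectors of mean zero. -/
def hyperplaneParam (n : ℕ) (m : ℝ) (v : LinearMap.ker (coordSum n).toLinearMap) :
    EuclideanSpace ℝ (Fin n) :=
  (v : EuclideanSpace ℝ (Fin n)) + WithLp.toLp 2 (fun _ => m)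

theorem isometry_hyperplaneParam (n : ℕ) (m : ℝ) : Isometry (hyperplaneParam n m) :=
  Isometry.of_dist_eq fun v w => by simp [hyperplaneParam]; rfl

theorem range_hyperplaneParam (n : ℕ) (m : ℝ) :
    range (hyperplaneParam n m) = {x | ∑ i, x i = (n : ℝ) * m} := by
  ext x
  constructor
  · rintro ⟨v, rfl⟩
    have := v.2
    rw [LinearMap.mem_ker] at this
    change coordSum n v = 0 at this
    rw [coordSum_apply] at this
    simp [hyperplaneParam, Finset.sum_add_distrib, this]
  · intro hx
    refine ⟨⟨x - WithLp.toLp 2 (fun _ => m), ?_⟩, ?_⟩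
    · rw [LinearMap.mem_ker]
      change coordSum n _ = 0
      rw [coordSum_apply]
      simp only [mem_ofPred_eq] at hx
      simp [Finset.sum_sub_distrib, hx]
    · simp [hyperplaneParam]

theorem hausdorffMeasure_restrict_hyperplane (n : ℕ) (m : ℝ) :
    (μH[((n + 1 : ℕ) : ℝ) - 1] : Measure (EuclideanSpace ℝ (Fin (n + 1)))).restrict
        {x | ∑ i, x i = ((n + 1 : ℕ) : ℝ) * m}
      = Measure.map (hyperplaneParam (n + 1) m)
        (μH[Module.finrank ℝ (LinearMap.ker (coordSum (n + 1)).toLinearMap)]) := by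
  rw [(isometry_hyperplaneParam (n + 1) m).map_hausdorffMeasure (Or.inl (Nat.cast_nonneg _)),
    range_hyperplaneParam, finrank_ker_coordSum]
  simp

theorem integral_fderiv_eq_zero {V : Type*} [NormedAddCommGroup V] [NormedSpace ℝ V]
    [FiniteDimensional ℝ V] [MeasurableSpace V] [BorelSpace V] (κ : Measure V)
    [κ.IsAddHaarMeasure] {G : V → ℝ} (hG : ContDiff ℝ 1 G) (hc : HasCompactSupport G) (v : V) :
    ∫ x, fderiv ℝ G x v ∂κ = 0 := by
  have hcont : Continuous fun x => fderiv ℝ G x v :=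
    (hG.continuous_fderiv one_ne_zero).clm_apply continuous_const
  have hc' : HasCompactSupport fun x => fderiv ℝ G x v := hc.fderiv_apply ℝ v
  have := integral_mul_fderiv_eq_neg_fderiv_mul_of_integrable (μ := κ) (f := fun _ => (1 : ℝ))
    (g := G) (v := v) (by simp)
    (by simpa using hcont.integrable_of_hasCompactSupport hc')
    (by simpa using hG.continuous.integrable_of_hasCompactSupport hc)
    (by simp) (fun x _ => hG.differentiable one_ne_zero x)
  simpa using this

/-- The divergence theorem on a hyperplane for compactly supported tangential vector fields. -/
theorem setIntegral_div_eq_zero (n : ℕ) (m : ℝ)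
    (F : Fin (n + 1) → EuclideanSpace ℝ (Fin (n + 1)) → ℝ) (hF : ∀ i, ContDiff ℝ 1 (F i))
    (hc : ∀ i, HasCompactSupport (F i)) (h0 : ∀ x, ∑ i, F i x = 0) :
    ∫ x in {x : EuclideanSpace ℝ (Fin (n + 1)) | ∑ i, x i = ((n + 1 : ℕ) : ℝ) * m},
      ∑ i, fderiv ℝ (F i) x (EuclideanSpace.single i 1) ∂μH[((n + 1 : ℕ) : ℝ) - 1] = 0 := by
  have hj := isometry_hyperplaneParam (n + 1) m
  have hjc : IsClosedEmbedding (hyperplaneParam (n + 1) m) := hj.isClosedEmbedding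
  rw [hausdorffMeasure_restrict_hyperplane, hjc.measurableEmbedding.integral_map]
  let V := LinearMap.ker (coordSum (n + 1)).toLinearMap
  let e : EuclideanSpace ℝ (Fin (n + 1)) := WithLp.toLp 2 fun _ => ((n + 1 : ℕ) : ℝ)⁻¹
  have hN : ((n + 1 : ℕ) : ℝ) ≠ 0 := by positivity
  have hmem : ∀ i : Fin (n + 1), EuclideanSpace.single i 1 - e ∈ V := fun i => by
    rw [LinearMap.mem_ker]
    change coordSum (n + 1) _ = 0
    rw [coordSum_apply]
    simp only [PiLp.sub_apply, Finset.sum_sub_distrib, e]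
    simp [-Nat.cast_add, hN]
  let w : Fin (n + 1) → V := fun i => ⟨_, hmem i⟩
  have hd : ∀ i (v : V), HasFDerivAt (fun v => F i (hyperplaneParam (n + 1) m v))
      ((fderiv ℝ (F i) (hyperplaneParam (n + 1) m v)).comp V.subtypeL) v := fun i v =>
    (((hF i).differentiable one_ne_zero _).hasFDerivAt).comp v (V.subtypeL.hasFDerivAt.add_const _)
  have key : ∀ v : V, ∑ i, fderiv ℝ (F i) (hyperplaneParam (n + 1) m v) (EuclideanSpace.single i 1)
      = ∑ i, fderiv ℝ (fun v => F i (hyperplaneParam (n + 1) m v)) v (w i) := by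
    intro v
    have hz : ∑ i, fderiv ℝ (F i) (hyperplaneParam (n + 1) m v) e = 0 := by
      have h1 : HasFDerivAt (fun x => ∑ i, F i x)
          (∑ i, fderiv ℝ (F i) (hyperplaneParam (n + 1) m v)) (hyperplaneParam (n + 1) m v) :=
        HasFDerivAt.fun_sum fun i _ => ((hF i).differentiable one_ne_zero _).hasFDerivAt
      have h2 : HasFDerivAt (fun x => ∑ i, F i x)
          (0 : EuclideanSpace ℝ (Fin (n + 1)) →L[ℝ] ℝ) (hyperplaneParam (n + 1) m v) := by
        rw [funext h0]; exact hasFDerivAt_const _ _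
      have := congrArg (fun L => L e) (h1.unique h2)
      simpa using this
    have : ∀ i, fderiv ℝ (fun v => F i (hyperplaneParam (n + 1) m v)) v (w i)
        = fderiv ℝ (F i) (hyperplaneParam (n + 1) m v) (EuclideanSpace.single i 1)
          - fderiv ℝ (F i) (hyperplaneParam (n + 1) m v) e := fun i => by
      rw [(hd i v).fderiv, ← map_sub]
      rfl
    simp_rw [this]
    rw [Finset.sum_sub_distrib, hz, sub_zero]
  have hC : ∀ i, ContDiff ℝ 1 (fun v : V => F i (hyperplaneParam (n + 1) m v)) := fun i =>
    (hF i).comp (V.subtypeL.contDiff.add contDiff_const)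
  have hS : ∀ i, HasCompactSupport (fun v : V => F i (hyperplaneParam (n + 1) m v)) := fun i =>
    (hc i).comp_isClosedEmbedding hjc
  simp_rw [key]
  rw [integral_finsetSum]
  · exact Finset.sum_eq_zero fun i _ => integral_fderiv_eq_zero _ (hC i) (hS i) (w i)
  · intro i _
    exact (((hC i).continuous_fderiv one_ne_zero).clm_apply
      continuous_const).integrable_of_hasCompactSupport ((hS i).fderiv_apply ℝ (w i))

end Hyperplane

theorem integral_canonEns (ψ : ℝ → ℝ) (hψ : Continuous ψ) (N : ℕ) (a : Fin N → ℝ) (m : ℝ) :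
    ∃ c : ℝ, ∀ Φ : EuclideanSpace ℝ (Fin N) → ℝ, ∫ x, Φ x ∂(canonEns ψ N a m)
      = c * ∫ x in {x : EuclideanSpace ℝ (Fin N) | ∑ i, x i = (N : ℝ) * m},
          Real.exp (-(∑ i, (ψ (x i) + a i * x i))) * Φ x ∂μH[(N : ℝ) - 1] := by
  refine ⟨((((μH[(N : ℝ) - 1] : Measure (EuclideanSpace ℝ (Fin N))).restrict
    {x | ∑ i, x i = (N : ℝ) * m}).withDensity fun x =>
      ENNReal.ofReal (Real.exp (-(∑ i, (ψ (x i) + a i * x i))))) Set.univ)⁻¹.toReal, fun Φ => ?_⟩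
  rw [canonEns, integral_smul_measure, integral_withDensity_eq_integral_toReal_smul
    (by fun_prop) (ae_of_all _ fun x => ENNReal.ofReal_lt_top)]
  simp only [ENNReal.toReal_ofReal (Real.exp_pos _).le, smul_eq_mul]

theorem gradient_apply_eq_fderiv {n : ℕ} {f : EuclideanSpace ℝ (Fin n) → ℝ}
    (x : EuclideanSpace ℝ (Fin n)) (i : Fin n) :
    gradient f x i = fderiv ℝ f x (EuclideanSpace.single i 1) := by
  have : inner ℝ (gradient f x) (EuclideanSpace.single i 1)
      = fderiv ℝ f x (EuclideanSpace.single i 1) := by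
    rw [gradient, InnerProductSpace.toDual_symm_apply]
  rw [← this, EuclideanSpace.inner_single_right]
  simp

/-- The squared length of the tangential gradient along hyperplanes of constant mean. -/
def tangentialGradSq {n : ℕ} (f : EuclideanSpace ℝ (Fin n) → ℝ)
    (x : EuclideanSpace ℝ (Fin n)) : ℝ :=
  ∑ i, (gradient f x i - (∑ j, gradient f x j) / (n : ℝ)) ^ 2

theorem tangentialGradSq_nonneg {n : ℕ} (f : EuclideanSpace ℝ (Fin n) → ℝ)
    (x : EuclideanSpace ℝ (Fin n)) : 0 ≤ tangentialGradSq f x :=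
  Finset.sum_nonneg fun _ _ => sq_nonneg _

theorem continuous_gradient_apply {n : ℕ} {f : EuclideanSpace ℝ (Fin n) → ℝ}
    (hf : ContDiff ℝ 1 f) (i : Fin n) : Continuous fun x => gradient f x i := by
  simp_rw [gradient_apply_eq_fderiv]
  exact (hf.continuous_fderiv one_ne_zero).clm_apply continuous_const

theorem continuous_tangentialGradSq {n : ℕ} {f : EuclideanSpace ℝ (Fin n) → ℝ}
    (hf : ContDiff ℝ 1 f) : Continuous (tangentialGradSq f) := by
  have := fun i => continuous_gradient_apply hf i
  exact continuous_finsetSum _ fun i _ =>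
    ((this i).sub ((continuous_finsetSum _ fun j _ => this j).div_const _)).pow 2

/-- A direction given by the difference of the barycenter and a point of the simplex pairs with
the gradient to at most the length of the tangential gradient. -/
theorem abs_sum_sub_mul_le {n : ℕ} (hn : n ≠ 0) (p g : Fin n → ℝ) (hp : ∀ i, 0 ≤ p i)
    (hp1 : ∑ i, p i = 1) :
    |∑ i, ((n : ℝ)⁻¹ - p i) * g i| ≤ √(∑ i, (g i - (∑ j, g j) / (n : ℝ)) ^ 2) := by
  have hn' : (n : ℝ) ≠ 0 := Nat.cast_ne_zero.2 hn
  have hu0 : ∑ i, ((n : ℝ)⁻¹ - p i) = 0 := by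
    rw [Finset.sum_sub_distrib, hp1]
    simp [hn']
  have h1 : ∑ i, ((n : ℝ)⁻¹ - p i) * g i
      = ∑ i, ((n : ℝ)⁻¹ - p i) * (g i - (∑ j, g j) / (n : ℝ)) := by
    simp_rw [mul_sub, Finset.sum_sub_distrib, ← Finset.sum_mul, hu0]
    simp
  have hu2 : ∑ i, ((n : ℝ)⁻¹ - p i) ^ 2 ≤ 1 := by
    have hple : ∀ i, p i ≤ 1 := fun i => by
      rw [← hp1]
      exact Finset.single_le_sum (fun j _ => hp j) (Finset.mem_univ i)
    have : ∀ i, ((n : ℝ)⁻¹ - p i) ^ 2 ≤ (n : ℝ)⁻¹ * ((n : ℝ)⁻¹ - p i) - (n : ℝ)⁻¹ * p i + p i :=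
      fun i => by nlinarith [hp i, hple i]
    refine (Finset.sum_le_sum fun i _ => this i).trans ?_
    rw [Finset.sum_add_distrib, Finset.sum_sub_distrib, ← Finset.mul_sum, ← Finset.mul_sum, hu0,
      hp1]
    have : 0 ≤ (n : ℝ)⁻¹ := by positivity
    linarith
  rw [h1]
  refine Real.abs_le_sqrt ?_
  refine (Finset.sum_mul_sq_le_sq_mul_sq _ _ _).trans ?_
  exact mul_le_of_le_one_left (Finset.sum_nonneg fun _ _ => sq_nonneg _) hu2

section Potential

variable {ψ : ℝ → ℝ} {lam0 : ℝ}

theorem monotone_sub_of_le_deriv (hψ : ContDiff ℝ 2 ψ) (hconv : ∀ x, lam0 ≤ deriv (deriv ψ) x) :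
    Monotone fun x => deriv ψ x - lam0 * x := by
  have hd : Differentiable ℝ (deriv ψ) :=
    (hψ.iterate_deriv' 1 1).differentiable one_ne_zero
  refine monotone_of_deriv_nonneg (hd.sub (by fun_prop)) fun x => ?_
  rw [deriv_fun_sub (hd x) (by fun_prop)]
  simp [hconv x]

theorem continuous_deriv_potential (hψ : ContDiff ℝ 2 ψ) : Continuous (deriv ψ) :=
  hψ.continuous_deriv (by norm_num)

/-- Freezing the force outside a large interval, each single-site measure is the measure of a
log-concave density with bounded score. -/
theorem exists_truncated_density (hlam0 : 0 < lam0) (hψ : ContDiff ℝ 2 ψ)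
    (hconv : ∀ x, lam0 ≤ deriv (deriv ψ) x) (a k : ℝ) (hk : |deriv ψ 0| + |a| < lam0 * k) :
    ∃ ρ θ, LogConcaveDensity ρ θ ∧ ∀ x, |x| ≤ k → θ x = -(deriv ψ x + a) := by
  have hm := monotone_sub_of_le_deriv hψ hconv
  have hk0 : 0 < k := by
    have : 0 < lam0 * k := lt_of_le_of_lt (by positivity) hk
    exact pos_of_mul_pos_right this hlam0.le
  have hmono : Monotone (deriv ψ) := fun x y hxy => by
    have := hm hxy
    simp only at this
    nlinarith
  let κ : ℝ → ℝ := fun x => max (-k) (min k x)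
  have hκ : ∀ x, |x| ≤ k → κ x = x := fun x hx => by
    have := abs_le.1 hx
    simp only [κ]
    rw [min_eq_right this.2, max_eq_right this.1]
  have hκm : Monotone κ := fun x y hxy => max_le_max le_rfl (min_le_min le_rfl hxy)
  have hκc : Continuous κ := by fun_prop
  have hκk : ∀ x, -k ≤ κ x ∧ κ x ≤ k := fun x =>
    ⟨le_max_left _ _, max_le (by linarith) (min_le_left _ _)⟩
  have habs := neg_abs_le (deriv ψ 0)
  have habs' := le_abs_self (deriv ψ 0)
  have haa := neg_abs_le a
  have haa' := le_abs_self a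
  have h1 : -(deriv ψ (κ k) + a) < 0 := by
    rw [hκ k (abs_of_pos hk0).le]
    have := hm hk0.le
    simp only at this
    linarith
  have h2 : 0 < -(deriv ψ (κ (-k)) + a) := by
    rw [hκ (-k) (by rw [abs_neg, abs_of_pos hk0])]
    have := hm (neg_nonpos.2 hk0.le)
    simp only at this
    linarith
  obtain ⟨ρ, hρ⟩ := exists_logConcaveDensity (θ := fun x => -(deriv ψ (κ x) + a)) (k := k)
    (((continuous_deriv_potential hψ).comp hκc).add continuous_const).neg
    (fun x y hxy => by
      have := hmono (hκm hxy)
      simp only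
      linarith)
    ⟨max |deriv ψ (-k)| |deriv ψ k| + |a|, fun x => by
      rw [abs_neg]
      refine (abs_add_le _ _).trans (add_le_add_left ?_ _)
      exact abs_le_max_abs_abs (hmono (hκk x).1) (hmono (hκk x).2)⟩
    h1 h2
  exact ⟨ρ, _, hρ, fun x hx => by simp only [hκ x hx]⟩

theorem abs_integral_mul_mean_force_le (hlam0 : 0 < lam0) (hψ : ContDiff ℝ 2 ψ)
    (hconv : ∀ x, lam0 ≤ deriv (deriv ψ) x) (n : ℕ) (m : ℝ) (a : Fin (n + 1) → ℝ)
    [IsFiniteMeasure (canonEns ψ (n + 1) a m)] {h : EuclideanSpace ℝ (Fin (n + 1)) → ℝ}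
    (hh : ContDiff ℝ 1 h) (hc : HasCompactSupport h)
    (h0 : ∫ x, h x ∂(canonEns ψ (n + 1) a m) = 0) :
    |∫ x, h x * ((1 / ((n + 1 : ℕ) : ℝ)) * ∑ i, deriv ψ (x i)) ∂(canonEns ψ (n + 1) a m)|
      ≤ ∫ x, √(tangentialGradSq h x) ∂(canonEns ψ (n + 1) a m) := by
  set μ := canonEns ψ (n + 1) a m with hμ
  have hN : ((n + 1 : ℕ) : ℝ) ≠ 0 := by positivity
  obtain ⟨K, hK⟩ : ∃ K, ∀ x ∈ tsupport h, ‖x‖ ≤ K := hc.isCompact.isBounded.exists_norm_le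
  obtain ⟨k, hkK, hk⟩ : ∃ k, K ≤ k ∧ ∀ i, |deriv ψ 0| + |a i| < lam0 * k := by
    refine ⟨max K ((|deriv ψ 0| + ∑ i, |a i| + 1) / lam0), le_max_left _ _, fun i => ?_⟩
    have h1 : (|deriv ψ 0| + ∑ i, |a i| + 1) / lam0 ≤ max K ((|deriv ψ 0| + ∑ i, |a i| + 1) / lam0) :=
      le_max_right _ _
    rw [div_le_iff₀ hlam0] at h1
    have h2 := Finset.single_le_sum (fun j _ => abs_nonneg (a j)) (Finset.mem_univ i)
    linarith
  choose ρ θ hρ hθ using fun i => exists_truncated_density hlam0 hψ hconv (a i) k (hk i)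
  have hθh : ∀ i (x : EuclideanSpace ℝ (Fin (n + 1))),
      h x * θ i (x i) = -(h x * (deriv ψ (x i) + a i)) := fun i x => by
    by_cases hx : x ∈ tsupport h
    · rw [hθ i (x i) (((PiLp.norm_apply_le x i).trans (hK x hx)).trans hkK)]
      ring
    · simp [image_eq_zero_of_notMem_tsupport hx]
  obtain ⟨Z, ζ, p, -, hp, hp0, hp1, hdiv⟩ := exists_simplex_field n ρ θ hρ
  let ι := EuclideanSpace.equiv (Fin (n + 1)) ℝ
  let u : Fin (n + 1) → EuclideanSpace ℝ (Fin (n + 1)) → ℝ :=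
    fun i x => ((n + 1 : ℕ) : ℝ)⁻¹ - p i (ι x)
  have hu : ∀ i, ContDiff ℝ 1 (u i) := fun i =>
    contDiff_const.sub ((hp i).comp ι.contDiff)
  have hu0 : ∀ x, ∑ i, u i x = 0 := fun x => by
    simp only [u]
    rw [Finset.sum_sub_distrib, hp1]
    simp [-Nat.cast_add, hN]
  have hud : ∀ i x, fderiv ℝ (u i) x (EuclideanSpace.single i 1)
      = -fderiv ℝ (p i) (ι x) (Pi.single i 1) := fun i x => by
    have h1 : HasFDerivAt (fun x => p i (ι x)) ((fderiv ℝ (p i) (ι x)).comp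
        (ι : EuclideanSpace ℝ (Fin (n + 1)) →L[ℝ] (Fin (n + 1) → ℝ))) x :=
      ((hp i).differentiable one_ne_zero (ι x)).hasFDerivAt.comp x ι.hasFDerivAt
    have h2 : HasFDerivAt (u i) _ x := h1.const_sub _
    rw [h2.fderiv]
    have h3 : ι (EuclideanSpace.single i 1) = Pi.single i 1 := by
      ext j; simp [ι, Pi.single_apply]
    simp [h3]
  let W : EuclideanSpace ℝ (Fin (n + 1)) → ℝ :=
    fun x => Real.exp (-(∑ i, (ψ (x i) + a i * x i)))
  have hψ1 : ContDiff ℝ 1 ψ := hψ.of_le (by norm_num)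
  have hcoord : ∀ i : Fin (n + 1), ContDiff ℝ 1 fun x : EuclideanSpace ℝ (Fin (n + 1)) => x i :=
    fun i => (EuclideanSpace.proj (𝕜 := ℝ) i).contDiff
  have hW : ContDiff ℝ 1 W := by
    refine Real.contDiff_exp.comp (ContDiff.neg (ContDiff.sum fun i _ => ?_))
    exact (hψ1.comp (hcoord i)).add (contDiff_const.mul (hcoord i))
  have hWd : ∀ i x, fderiv ℝ W x (EuclideanSpace.single i 1)
      = -(W x * (deriv ψ (x i) + a i)) := fun i x => by
    have h1 : ∀ j : Fin (n + 1), HasFDerivAt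
        (fun x : EuclideanSpace ℝ (Fin (n + 1)) => ψ (x j) + a j * x j)
        ((deriv ψ (x j) + a j) • (EuclideanSpace.proj (𝕜 := ℝ) j :
          EuclideanSpace ℝ (Fin (n + 1)) →L[ℝ] ℝ)) x := fun j => by
      have hy : HasDerivAt (fun y => ψ y + a j * y) (deriv ψ (x j) + a j) (x j) := by
        simpa using ((hψ1.differentiable one_ne_zero (x j)).hasDerivAt).fun_add
          ((hasDerivAt_id (x j)).const_mul (a j))
      exact hy.comp_hasFDerivAt x (EuclideanSpace.proj (𝕜 := ℝ) j :
          EuclideanSpace ℝ (Fin (n + 1)) →L[ℝ] ℝ).hasFDerivAt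
    have h2 : HasFDerivAt W _ x := (HasFDerivAt.fun_sum fun j _ => h1 j).neg.exp
    rw [h2.fderiv]
    simp [W]
  let F : Fin (n + 1) → EuclideanSpace ℝ (Fin (n + 1)) → ℝ := fun i x => u i x * (h x * W x)
  have hFd : ∀ i x, fderiv ℝ (F i) x (EuclideanSpace.single i 1)
      = W x * (u i x * fderiv ℝ h x (EuclideanSpace.single i 1)
        + h x * fderiv ℝ (u i) x (EuclideanSpace.single i 1)
        - u i x * (h x * (deriv ψ (x i) + a i))) := fun i x => by
    have h1 : HasFDerivAt (F i) _ x := ((hu i).differentiable one_ne_zero x).hasFDerivAt.mul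
      ((hh.differentiable one_ne_zero x).hasFDerivAt.mul
        (hW.differentiable one_ne_zero x).hasFDerivAt)
    rw [h1.fderiv]
    simp [hWd]
    ring
  have hdivF := setIntegral_div_eq_zero n m F (fun i => (hu i).mul (hh.mul hW))
    (fun i => (hc.mul_right).mul_left) fun x => by
      simp only [F]
      rw [← Finset.sum_mul, hu0, zero_mul]
  let c₀ : ℝ := ζ (((n + 1 : ℕ) : ℝ) * m) + ((n + 1 : ℕ) : ℝ)⁻¹ * ∑ i, a i
  let g : EuclideanSpace ℝ (Fin (n + 1)) → ℝ :=
    fun x => (1 / ((n + 1 : ℕ) : ℝ)) * ∑ i, deriv ψ (x i)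
  have hdivF' : ∀ x : EuclideanSpace ℝ (Fin (n + 1)), ∑ i, x i = ((n + 1 : ℕ) : ℝ) * m →
      ∑ i, fderiv ℝ (F i) x (EuclideanSpace.single i 1)
        = W x * (∑ i, u i x * gradient h x i - (h x * g x + h x * c₀)) := fun x hx => by
    have h1 := hdiv (ι x)
    have hι : ∀ i, ι x i = x i := fun i => rfl
    simp only [hι, hx] at h1
    have h2 : h x * c₀ + h x * g x = ∑ i, (h x * (fderiv ℝ (p i) (ι x) (Pi.single i 1))
        + u i x * (h x * (deriv ψ (x i) + a i))) := by
      have h3 : ∀ i, h x * (fderiv ℝ (p i) (ι x) (Pi.single i 1))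
          + u i x * (h x * (deriv ψ (x i) + a i))
          = h x * (fderiv ℝ (p i) (ι x) (Pi.single i 1) + p i (ι x) * θ i (x i))
            + ((n + 1 : ℕ) : ℝ)⁻¹ * (h x * deriv ψ (x i)) + ((n + 1 : ℕ) : ℝ)⁻¹ * (h x * a i) :=
        fun i => by
          have := hθh i x
          simp only [u]
          linear_combination (-p i (ι x)) * this
      simp_rw [h3]
      rw [Finset.sum_add_distrib, Finset.sum_add_distrib, ← Finset.mul_sum, h1,
        ← Finset.mul_sum, ← Finset.mul_sum, ← Finset.mul_sum, ← Finset.mul_sum]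
      simp only [c₀, g, one_div]
      ring
    rw [add_comm (h x * g x), h2, ← Finset.sum_sub_distrib, Finset.mul_sum]
    refine Finset.sum_congr rfl fun i _ => ?_
    rw [hFd, hud, gradient_apply_eq_fderiv]
    ring
  obtain ⟨C, hC⟩ := integral_canonEns ψ hψ.continuous (n + 1) a m
  have hzero : ∫ x, (∑ i, u i x * gradient h x i - (h x * g x + h x * c₀)) ∂μ = 0 := by
    rw [hμ, hC]
    have hms : MeasurableSet
        {x : EuclideanSpace ℝ (Fin (n + 1)) | ∑ i, x i = ((n + 1 : ℕ) : ℝ) * m} :=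
      (isClosed_eq (by fun_prop) continuous_const).measurableSet
    rw [← setIntegral_congr_fun hms fun x hx => hdivF' x hx, hdivF, mul_zero]
  have hgc : Continuous g := by
    have := continuous_deriv_potential hψ
    fun_prop
  have hgrad : ∀ i, HasCompactSupport fun x => gradient h x i := fun i => by
    simp_rw [gradient_apply_eq_fderiv]
    exact hc.fderiv_apply ℝ _
  have i1 : Integrable (fun x => h x * g x) μ :=
    (hh.continuous.mul hgc).integrable_of_hasCompactSupport hc.mul_right
  have i2 : Integrable (fun x => h x * c₀) μ :=
    (hh.continuous.mul continuous_const).integrable_of_hasCompactSupport hc.mul_right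
  have i3 : Integrable (fun x => ∑ i, u i x * gradient h x i) μ :=
    integrable_finsetSum _ fun i _ => ((hu i).continuous.mul
      (continuous_gradient_apply hh i)).integrable_of_hasCompactSupport (hgrad i).mul_left
  have i12 : Integrable (fun x => h x * g x + h x * c₀) μ := i1.add i2
  rw [integral_sub i3 i12, integral_add i1 i2, integral_mul_const, h0, zero_mul,
    add_zero, sub_eq_zero] at hzero
  rw [← hzero]
  refine abs_integral_le_integral_abs.trans (integral_mono_of_nonneg (ae_of_all _ fun x =>
    abs_nonneg _) ?_ (ae_of_all _ fun x => ?_))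
  · refine (continuous_tangentialGradSq hh).sqrt.integrable_of_hasCompactSupport ?_
    refine hc.fderiv (𝕜 := ℝ) |>.mono fun x hx => ?_
    contrapose! hx
    have : gradient h x = 0 := by
      rw [Function.notMem_support] at hx
      rw [gradient, hx, map_zero]
    simp [tangentialGradSq, this]
  · exact abs_sum_sub_mul_le (Nat.succ_ne_zero n) (fun i => p i (ι x)) _ (fun i => hp0 i _)
      (hp1 _)

end Potential

/-- The component of a vector orthogonal to the constant vectors. -/
def centering (n : ℕ) : EuclideanSpace ℝ (Fin n) →L[ℝ] EuclideanSpace ℝ (Fin n) :=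
  LinearMap.toContinuousLinearMap
    { toFun := fun v => WithLp.toLp 2 fun i => v i - (∑ j, v j) / (n : ℝ)
      map_add' := fun v w => by
        ext i
        simp [Finset.sum_add_distrib]
        ring
      map_smul' := fun c v => by
        ext i
        simp [← Finset.mul_sum]
        ring }

theorem sqrt_tangentialGradSq {n : ℕ} (f : EuclideanSpace ℝ (Fin n) → ℝ)
    (x : EuclideanSpace ℝ (Fin n)) : √(tangentialGradSq f x) = ‖centering n (gradient f x)‖ := by
  simp [EuclideanSpace.norm_eq, tangentialGradSq, centering]

theorem exists_cutoff (E : Type*) [NormedAddCommGroup E] [InnerProductSpace ℝ E]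
    [FiniteDimensional ℝ E] :
    ∃ (χ : ℕ → E → ℝ) (L : ℝ), (∀ n, ContDiff ℝ 1 (χ n)) ∧ (∀ n, HasCompactSupport (χ n)) ∧
      (∀ n x, 0 ≤ χ n x ∧ χ n x ≤ 1) ∧ (∀ x, ∀ᶠ n in atTop, χ n x = 1) ∧
      ∀ n x, ‖gradient (χ n) x‖ ≤ ((n : ℝ) + 1)⁻¹ * L := by
  let b : ContDiffBump (0 : E) := ⟨1, 2, one_pos, one_lt_two⟩
  have hb : ContDiff ℝ 1 b := b.contDiff
  obtain ⟨L, hL⟩ := (b.hasCompactSupport.fderiv ℝ).exists_bound_of_continuous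
    (hb.continuous_fderiv one_ne_zero)
  have hpos : ∀ n : ℕ, (0 : ℝ) < ((n : ℝ) + 1)⁻¹ := fun n => by positivity
  refine ⟨fun n x => b (((n : ℝ) + 1)⁻¹ • x), L, fun n => hb.comp (contDiff_const_smul _),
    fun n => ?_, fun n x => ⟨b.nonneg, b.le_one⟩, fun x => ?_, fun n x => ?_⟩
  · exact b.hasCompactSupport.comp_smul (hpos n).ne'
  · have h1 : Tendsto (fun n : ℕ => ((n : ℝ) + 1)⁻¹ • x) atTop (𝓝 0) := by
      have := (tendsto_one_div_add_atTop_nhds_zero_nat (𝕜 := ℝ)).smul_const x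
      simpa using this
    filter_upwards [h1 (Metric.closedBall_mem_nhds (0 : E) one_pos)] with n hn
    exact b.one_of_mem_closedBall hn
  · have h1 : HasFDerivAt (fun x => b (((n : ℝ) + 1)⁻¹ • x)) _ x :=
      ((hb.differentiable one_ne_zero) _).hasFDerivAt.comp x
        ((hasFDerivAt_id x).const_smul ((n : ℝ) + 1)⁻¹)
    rw [gradient, LinearIsometryEquiv.norm_map, h1.fderiv, ContinuousLinearMap.comp_smul, norm_smul,
      ContinuousLinearMap.comp_id, Real.norm_of_nonneg (hpos n).le]
    exact mul_le_mul_of_nonneg_left (hL _) (hpos n).le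

theorem tendsto_integral_cutoff_mul {X : Type*} [MeasurableSpace X] {μ : Measure X}
    {χ : ℕ → X → ℝ} {F : X → ℝ} (hF : Integrable F μ)
    (hm : ∀ n, AEStronglyMeasurable (χ n) μ) (hb : ∀ n x, 0 ≤ χ n x ∧ χ n x ≤ 1)
    (h1 : ∀ x, ∀ᶠ n in atTop, χ n x = 1) :
    Tendsto (fun n => ∫ x, χ n x * F x ∂μ) atTop (𝓝 (∫ x, F x ∂μ)) := by
  refine tendsto_integral_of_dominated_convergence (fun x => ‖F x‖)
    (fun n => (hm n).mul hF.1) hF.norm (fun n => ae_of_all _ fun x => ?_)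
    (ae_of_all _ fun x => ?_)
  · rw [norm_mul, Real.norm_of_nonneg (hb n x).1]
    exact mul_le_of_le_one_left (norm_nonneg _) (hb n x).2
  · refine tendsto_const_nhds.congr' ?_
    filter_upwards [h1 x] with n hn
    rw [hn, one_mul]

theorem sqrt_tangentialGradSq_mul_sub_le {n : ℕ} {f χ : EuclideanSpace ℝ (Fin n) → ℝ}
    {x : EuclideanSpace ℝ (Fin n)} {K c : ℝ} (hf : DifferentiableAt ℝ f x)
    (hχ : DifferentiableAt ℝ χ x) (hf0 : 0 ≤ f x) (hχ0 : 0 ≤ χ x) (hχ1 : χ x ≤ 1)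
    (hK : ‖gradient χ x‖ ≤ K) :
    √(tangentialGradSq (fun y => χ y * (f y - c)) x)
      ≤ √(tangentialGradSq f x) + (f x + |c|) * (‖centering n‖ * K) := by
  have h1 : gradient (fun y => χ y * (f y - c)) x
      = χ x • gradient f x + (f x - c) • gradient χ x := by
    have : HasFDerivAt (fun y => χ y * (f y - c)) _ x :=
      hχ.hasFDerivAt.mul (hf.hasFDerivAt.sub_const c)
    rw [gradient, this.fderiv]
    simp [gradient]
  rw [sqrt_tangentialGradSq, sqrt_tangentialGradSq, h1, map_add, map_smul, map_smul]
  refine (norm_add_le _ _).trans (add_le_add ?_ ?_)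
  · rw [norm_smul, Real.norm_of_nonneg hχ0]
    exact mul_le_of_le_one_left (norm_nonneg _) hχ1
  · rw [norm_smul]
    refine mul_le_mul ?_ ?_ (norm_nonneg _) (by positivity)
    · refine (norm_sub_le _ _).trans ?_
      rw [Real.norm_of_nonneg hf0, Real.norm_eq_abs]
    · exact (ContinuousLinearMap.le_opNorm _ _).trans
        (mul_le_mul_of_nonneg_left hK (norm_nonneg _))

theorem abs_covFn_le_integral_sqrt {ψ : ℝ → ℝ} {lam0 : ℝ} (hlam0 : 0 < lam0) (hψ : ContDiff ℝ 2 ψ)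
    (hconv : ∀ x, lam0 ≤ deriv (deriv ψ) x) (n : ℕ) (m : ℝ) (a : Fin (n + 1) → ℝ)
    [IsProbabilityMeasure (canonEns ψ (n + 1) a m)] {f : EuclideanSpace ℝ (Fin (n + 1)) → ℝ}
    (hf : ContDiff ℝ 1 f) (hf0 : ∀ x, 0 ≤ f x) (hfi : Integrable f (canonEns ψ (n + 1) a m))
    (hf1 : ∫ x, f x ∂(canonEns ψ (n + 1) a m) = 1)
    (hfg : Integrable (fun x => f x * ((1 / ((n + 1 : ℕ) : ℝ)) * ∑ i, deriv ψ (x i)))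
      (canonEns ψ (n + 1) a m))
    (hg : Integrable (fun x : EuclideanSpace ℝ (Fin (n + 1)) =>
      (1 / ((n + 1 : ℕ) : ℝ)) * ∑ i, deriv ψ (x i)) (canonEns ψ (n + 1) a m))
    (hT : Integrable (fun x => √(tangentialGradSq f x)) (canonEns ψ (n + 1) a m)) :
    |covFn (canonEns ψ (n + 1) a m) f (fun x => (1 / ((n + 1 : ℕ) : ℝ)) * ∑ i, deriv ψ (x i))|
      ≤ ∫ x, √(tangentialGradSq f x) ∂(canonEns ψ (n + 1) a m) := by
  set μ := canonEns ψ (n + 1) a m with hμ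
  set g : EuclideanSpace ℝ (Fin (n + 1)) → ℝ :=
    fun x => (1 / ((n + 1 : ℕ) : ℝ)) * ∑ i, deriv ψ (x i) with hgdef
  obtain ⟨χ, L, hχd, hχc, hχ, hχ1, hχL⟩ := exists_cutoff (EuclideanSpace ℝ (Fin (n + 1)))
  have hχm : ∀ k, AEStronglyMeasurable (χ k) μ := fun k =>
    (hχd k).continuous.aestronglyMeasurable
  have hlim : ∀ {F : EuclideanSpace ℝ (Fin (n + 1)) → ℝ}, Integrable F μ →
      Tendsto (fun k => ∫ x, χ k x * F x ∂μ) atTop (𝓝 (∫ x, F x ∂μ)) := fun hF =>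
    tendsto_integral_cutoff_mul hF hχm hχ hχ1
  have hχF : ∀ {F : EuclideanSpace ℝ (Fin (n + 1)) → ℝ}, Integrable F μ → ∀ k,
      Integrable (fun x => χ k x * F x) μ := fun hF k =>
    hF.bdd_mul (c := 1) (hχm k) (ae_of_all _ fun x => by
      rw [Real.norm_of_nonneg (hχ k x).1]
      exact (hχ k x).2)
  have hZ : Tendsto (fun k => ∫ x, χ k x ∂μ) atTop (𝓝 1) := by
    simpa using hlim (integrable_const (1 : ℝ))
  let c : ℕ → ℝ := fun k => (∫ x, χ k x * f x ∂μ) / ∫ x, χ k x ∂μ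
  have hc : Tendsto c atTop (𝓝 1) := by
    have := (hlim hfi).div hZ one_ne_zero
    rwa [hf1, div_one] at this
  have hleft : Tendsto (fun k => |(∫ x, χ k x * (f x * g x) ∂μ) - c k * ∫ x, χ k x * g x ∂μ|) atTop
      (𝓝 |covFn μ f g|) := by
    rw [covFn, hf1]
    exact ((hlim hfg).sub (hc.mul (hlim hg))).abs
  have hright : Tendsto (fun k : ℕ => (∫ x, √(tangentialGradSq f x) ∂μ)
      + (1 + |c k|) * (‖centering (n + 1)‖ * (((k : ℝ) + 1)⁻¹ * L))) atTop
      (𝓝 (∫ x, √(tangentialGradSq f x) ∂μ)) := by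
    have h1 : Tendsto (fun k : ℕ => ((k : ℝ) + 1)⁻¹) atTop (𝓝 0) := by
      simpa using tendsto_one_div_add_atTop_nhds_zero_nat (𝕜 := ℝ)
    simpa using ((hc.abs.const_add 1).mul ((h1.mul_const L).const_mul
      ‖centering (n + 1)‖)).const_add (∫ x, √(tangentialGradSq f x) ∂μ)
  refine le_of_tendsto_of_tendsto hleft hright ?_
  filter_upwards [hZ.eventually_ne one_ne_zero] with k hk
  have hχi : Integrable (χ k) μ := by simpa using hχF (integrable_const (1 : ℝ)) k
  have hhd : ContDiff ℝ 1 fun x => χ k x * (f x - c k) := (hχd k).mul (hf.sub contDiff_const)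
  have hmean : ∫ x, χ k x * (f x - c k) ∂μ = 0 := by
    simp_rw [mul_sub]
    rw [integral_sub (hχF hfi k) (hχi.mul_const _), integral_mul_const]
    simp only [c]
    field_simp
    ring
  have hmain := abs_integral_mul_mean_force_le hlam0 hψ hconv n m a hhd (hχc k).mul_right hmean
  have hsplit : ∫ x, χ k x * (f x - c k) * g x ∂μ
      = (∫ x, χ k x * (f x * g x) ∂μ) - c k * ∫ x, χ k x * g x ∂μ := by
    rw [← integral_const_mul, ← integral_sub (hχF hfg k) ((hχF hg k).const_mul _)]
    congr 1 with x
    ring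
  rw [← hμ, hsplit] at hmain
  refine hmain.trans ?_
  have hb : Integrable (fun x => (f x + |c k|) * (‖centering (n + 1)‖ * (((k : ℝ) + 1)⁻¹ * L))) μ :=
    (hfi.add (integrable_const _)).mul_const _
  calc ∫ x, √(tangentialGradSq (fun y => χ k y * (f y - c k)) x) ∂μ
      ≤ ∫ x, (√(tangentialGradSq f x)
        + (f x + |c k|) * (‖centering (n + 1)‖ * (((k : ℝ) + 1)⁻¹ * L))) ∂μ := by
        refine integral_mono_of_nonneg (ae_of_all _ fun x => Real.sqrt_nonneg _) (hT.add hb)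
          (ae_of_all _ fun x => ?_)
        exact sqrt_tangentialGradSq_mul_sub_le (hf.differentiable one_ne_zero x)
          ((hχd k).differentiable one_ne_zero x) (hf0 x) (hχ k x).1 (hχ k x).2 (hχL k x)
    _ = _ := by
        rw [integral_add hT hb, integral_mul_const, integral_add hfi (integrable_const _), hf1]
        simp

theorem tangentialGradSq_eq_mul_fisherX {n : ℕ} {f : EuclideanSpace ℝ (Fin n) → ℝ}
    (hf0 : ∀ x, 0 ≤ f x) (x : EuclideanSpace ℝ (Fin n)) :
    tangentialGradSq f x = f x * fisherX n f x := by
  by_cases hx : f x = 0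
  · have hmin : IsLocalMin f x := Eventually.of_forall fun y => by rw [hx]; exact hf0 y
    have : gradient f x = 0 := by rw [gradient, hmin.fderiv_eq_zero, map_zero]
    simp [tangentialGradSq, this, hx]
  · rw [fisherX, if_neg hx, mul_div_cancel₀ _ hx, tangentialGradSq]

theorem fisherX_nonneg {n : ℕ} {f : EuclideanSpace ℝ (Fin n) → ℝ} (hf0 : ∀ x, 0 ≤ f x)
    (x : EuclideanSpace ℝ (Fin n)) : 0 ≤ fisherX n f x := by
  unfold fisherX
  split_ifs
  · exact le_rfl
  · exact div_nonneg (Finset.sum_nonneg fun _ _ => sq_nonneg _) (hf0 x)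

theorem isProbabilityMeasure_canonEns {ψ : ℝ → ℝ} {N : ℕ} {a : Fin N → ℝ} {m : ℝ}
    (h : canonEns ψ N a m ≠ 0) : IsProbabilityMeasure (canonEns ψ N a m) := by
  rw [canonEns] at h ⊢
  dsimp only at h ⊢
  generalize Measure.withDensity _ _ = ν at h ⊢
  have h0 : ν univ ≠ 0 := fun h' => h (by rw [Measure.measure_univ_eq_zero.1 h', smul_zero])
  have htop : ν univ ≠ ⊤ := fun h' => h (by rw [h', ENNReal.inv_top, zero_smul])
  exact ⟨by rw [Measure.smul_apply, smul_eq_mul, ENNReal.inv_mul_cancel h0 htop]⟩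

/-- The square of the integral of `√(u v)` is bounded by that of `v` when `u` is a probability
density. -/
theorem integrable_and_sq_integral_le {X : Type*} [MeasurableSpace X] {μ : Measure X}
    {u v w : X → ℝ} (hu : Integrable u μ) (hv : Integrable v μ) (hu0 : ∀ x, 0 ≤ u x)
    (hv0 : ∀ x, 0 ≤ v x) (hw : AEStronglyMeasurable w μ) (hw0 : ∀ x, 0 ≤ w x)
    (hwuv : ∀ x, w x ^ 2 = u x * v x) (hu1 : ∫ x, u x ∂μ = 1) :
    Integrable w μ ∧ (∫ x, w x ∂μ) ^ 2 ≤ ∫ x, v x ∂μ := by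
  have hpt : ∀ t : ℝ, ∀ x, 2 * t * w x ≤ t ^ 2 * u x + v x := fun t x => by
    have h1 := hu0 x
    have h2 := hv0 x
    have h3 := hwuv x
    have h4 : (2 * t * w x) ^ 2 ≤ (t ^ 2 * u x + v x) ^ 2 := by
      nlinarith [sq_nonneg (t ^ 2 * u x - v x)]
    exact (abs_le_of_sq_le_sq' h4 (by positivity)).2
  have hwi : Integrable w μ := by
    refine (hu.add hv).mono' hw (ae_of_all _ fun x => ?_)
    rw [Real.norm_of_nonneg (hw0 x)]
    have := hpt 1 x
    have := hw0 x
    simp only [Pi.add_apply]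
    linarith
  refine ⟨hwi, ?_⟩
  have h := integral_mono (hwi.const_mul (2 * ∫ x, w x ∂μ))
    ((hu.const_mul ((∫ x, w x ∂μ) ^ 2)).add hv) fun x => hpt (∫ x, w x ∂μ) x
  rw [integral_const_mul, integral_add' (hu.const_mul _) hv, integral_const_mul, hu1] at h
  linarith

/-- Covariance estimate for the canonical ensemble with uniformly strictly
convex single-site potential: there is `C` depending only on `ψ` such that
`|cov(f, (1/N)∑ψ'(xᵢ))|² ≤ C N ∫ |∇f|²/f dμ_{N,a,m}` for all `N`, `m`, `a` and all
probability densities `f`. -/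
theorem statement6
    (ψ : ℝ → ℝ) (lam0 : ℝ) (hlam0 : 0 < lam0)
    (hψ : ContDiff ℝ 2 ψ)
    (hconv : ∀ x, lam0 ≤ deriv (deriv ψ) x) :
    ∃ C : ℝ, 0 < C ∧ ∀ (N : ℕ) (m : ℝ) (a : Fin N → ℝ),
      ∀ f : EuclideanSpace ℝ (Fin N) → ℝ, ContDiff ℝ (⊤ : ℕ∞) f → (∀ x, 0 ≤ f x) →
        Integrable f (canonEns ψ N a m) →
        (∫ x, f x ∂(canonEns ψ N a m)) = 1 →
        Integrable (fun x => f x * ((1 / (N : ℝ)) * ∑ i, deriv ψ (x i))) (canonEns ψ N a m) →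
        Integrable (fun x => (1 / (N : ℝ)) * ∑ i, deriv ψ (x i)) (canonEns ψ N a m) →
        Integrable (fisherX N f) (canonEns ψ N a m) →
        (covFn (canonEns ψ N a m) f (fun x => (1 / (N : ℝ)) * ∑ i, deriv ψ (x i))) ^ 2
          ≤ C * N * ∫ x, fisherX N f x ∂(canonEns ψ N a m) := by
  refine ⟨1, one_pos, fun N m a f hf hf0 hfi hf1 hfg hg hI => ?_⟩
  have hμ0 : canonEns ψ N a m ≠ 0 := fun h => by simp [h] at hf1
  have := isProbabilityMeasure_canonEns hμ0
  obtain - | n := N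
  · simp [covFn]
  have hf' : ContDiff ℝ 1 f := hf.of_le (by exact_mod_cast le_top)
  obtain ⟨hT, hTI⟩ := integrable_and_sq_integral_le (w := fun x => √(tangentialGradSq f x)) hfi hI
    hf0 (fisherX_nonneg hf0) (continuous_tangentialGradSq hf').sqrt.aestronglyMeasurable
    (fun x => Real.sqrt_nonneg _)
    (fun x => by rw [Real.sq_sqrt (tangentialGradSq_nonneg f x),
      tangentialGradSq_eq_mul_fisherX hf0]) hf1
  have hcov := abs_covFn_le_integral_sqrt hlam0 hψ hconv n m a hf' hf0 hfi hf1 hfg hg hT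
  have hI0 : 0 ≤ ∫ x, fisherX (n + 1) f x ∂(canonEns ψ (n + 1) a m) :=
    integral_nonneg (fisherX_nonneg hf0)
  calc _ ≤ (∫ x, √(tangentialGradSq f x) ∂(canonEns ψ (n + 1) a m)) ^ 2 := by
        rw [← sq_abs]
        exact pow_le_pow_left₀ (abs_nonneg _) hcov 2
    _ ≤ _ := hTI
    _ ≤ _ := by
        refine le_mul_of_one_le_left hI0 ?_
        push_cast
        linarith [Nat.cast_nonneg (α := ℝ) n]
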